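/- Let n ≥ 2, let E₁, …, Eₙ be alphabets, let E_s = ∪_{i≠j}(Eᵢ ∩ Eⱼ), and let E_k satisfy E_s ⊆ E_k ⊆ E := E₁ ∪ … ∪ Eₙ. For i = 1, …, n let (Kᵢ, Nᵢ) model a nonblocking generator over Eᵢ (so Nᵢ = overline(Kᵢ)) and let (K_k, N_k) model a nonblocking generator over E_k. Assume K_k = ∩_{i=1}^{n} P_k(Kᵢ) and N_k = ∩_{i=1}^{n} P_k(Nᵢ), and assume that for each i = 1, …, n the natural projection from Eᵢ* onto (Eᵢ ∩ E_k)* is a Kᵢ-observer. Then the coordinated system is nonblocking, i.e., overline(K₁ ∥ … ∥ Kₙ ∥ K_k) = N₁ ∥ … ∥ Nₙ ∥ N_k, if and only if the coordinator is nonblocking, i.e., overline(K_k) = N_k. -/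

import Mathlib

/- Language-theoretic model of discrete-event systems:
   strings over a finite alphabet (a `Finset` of symbols) are lists,
   natural projections erase letters outside the target alphabet,
   and the parallel composition is the standard synchronous composition. -/

namespace DES

variable {A : Type} [DecidableEq A]

/-- `star E` is `E*`: the set of finite strings over the alphabet `E`. -/
def star (E : Finset A) : Set (List A) :=
  {w | ∀ a ∈ w, a ∈ E}

/-- The natural projection onto `E₀`: it keeps letters of `E₀` and erases all
other letters. -/
def proj (E₀ : Finset A) (w : List A) : List A :=
  w.filter (· ∈ E₀)

/-- The inverse image `P⁻¹(L) = { s ∈ E* : P(s) ∈ L }` of the natural projection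
from `E*` onto `E₀*`. -/
def invProj (E E₀ : Finset A) (L : Set (List A)) : Set (List A) :=
  {s | s ∈ star E ∧ proj E₀ s ∈ L}

/-- Parallel composition `L₁ ∥ L₂ = P₁⁻¹(L₁) ∩ P₂⁻¹(L₂) ⊆ (E₁ ∪ E₂)*` of
`L₁ ⊆ E₁*` and `L₂ ⊆ E₂*`. -/
def par (E₁ E₂ : Finset A) (L₁ L₂ : Set (List A)) : Set (List A) :=
  invProj (E₁ ∪ E₂) E₁ L₁ ∩ invProj (E₁ ∪ E₂) E₂ L₂

/-- Parallel composition of a finite family `L i ⊆ (E i)*`. -/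
def parFam {ι : Type} [Fintype ι] (E : ι → Finset A) (L : ι → Set (List A)) :
    Set (List A) :=
  {w | w ∈ star (Finset.univ.sup E) ∧ ∀ i, proj (E i) w ∈ L i}

/-- The prefix closure of a language. -/
def pref (L : Set (List A)) : Set (List A) :=
  {w | ∃ u, w ++ u ∈ L}

/-- `K` is conditionally decomposable w.r.t. the alphabets `E i` and `Ek`:
`K = P_{1+k}(K) ∥ ⋯ ∥ P_{n+k}(K)`. -/
def condDecomp {ι : Type} [Fintype ι] (E : ι → Finset A) (Ek : Finset A)
    (K : Set (List A)) : Prop :=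
  K = parFam (fun i => E i ∪ Ek) (fun i => proj (E i ∪ Ek) '' K)

/-- Conditional decomposability for two components:
`K = P_{1+k}(K) ∥ P_{2+k}(K)`. -/
def condDecomp2 (E₁ E₂ Ek : Finset A) (K : Set (List A)) : Prop :=
  K = par (E₁ ∪ Ek) (E₂ ∪ Ek) (proj (E₁ ∪ Ek) '' K) (proj (E₂ ∪ Ek) '' K)

/-- The natural projection from `E'*` onto `E₀*` is an `L`-observer. -/
def observer (E' E₀ : Finset A) (L : Set (List A)) : Prop :=
  ∀ t ∈ proj E₀ '' L, ∀ s ∈ pref L, proj E₀ s <+: t →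
    ∃ u ∈ star E', s ++ u ∈ L ∧ proj E₀ (s ++ u) = t

/-- Letter-to-letter renaming map: letters in `Ekeep` are kept, all other
letters are renamed by `g`. -/
def ren (Ekeep : Finset A) (g : A → A) (w : List A) : List A :=
  w.map (fun a => if a ∈ Ekeep then a else g a)


@[simp]
theorem proj_append (E₀ : Finset A) (v w : List A) :
    proj E₀ (v ++ w) = proj E₀ v ++ proj E₀ w :=
  List.filter_append ..

theorem proj_proj (E₁ E₂ : Finset A) (w : List A) :
    proj E₁ (proj E₂ w) = proj (E₁ ∩ E₂) w := by
  simp [proj, List.filter_filter, Finset.mem_inter]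

theorem proj_eq_self {E₀ : Finset A} {w : List A} (hw : w ∈ star E₀) : proj E₀ w = w :=
  List.filter_eq_self.2 fun a ha => by simpa using hw a ha

theorem proj_eq_nil {E₀ : Finset A} {w : List A} : proj E₀ w = [] ↔ ∀ a ∈ w, a ∉ E₀ := by
  simp [proj, List.filter_eq_nil_iff]

theorem proj_inter_of_mem_star {E₁ E₂ : Finset A} {w : List A} (hw : w ∈ star E₁) :
    proj (E₁ ∩ E₂) w = proj E₂ w := by
  rw [Finset.inter_comm, ← proj_proj, proj_eq_self hw]

theorem append_mem_star {E₀ : Finset A} {v w : List A} :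
    v ++ w ∈ star E₀ ↔ v ∈ star E₀ ∧ w ∈ star E₀ := by
  simp [star, or_imp, forall_and]

theorem star_mono {E₁ E₂ : Finset A} (h : E₁ ⊆ E₂) : star E₁ ⊆ star E₂ :=
  fun _ hw a ha => h (hw a ha)

theorem mem_par_parFam {ι : Type} [Fintype ι] {E : ι → Finset A} {Ek : Finset A}
    (hkE : Ek ⊆ Finset.univ.sup E) {L : ι → Set (List A)} {M : Set (List A)} {w : List A} :
    w ∈ par (Finset.univ.sup E) Ek (parFam E L) M ↔
      w ∈ star (Finset.univ.sup E) ∧ (∀ i, proj (E i) w ∈ L i) ∧ proj Ek w ∈ M := by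
  simp only [par, invProj, parFam, Finset.union_eq_left.2 hkE, Set.mem_inter_iff,
    Set.mem_ofPred_eq]
  constructor
  · rintro ⟨⟨h, -, h'⟩, -, h''⟩
    exact ⟨h, by rwa [proj_eq_self h] at h', h''⟩
  · rintro ⟨h, h', h''⟩
    rw [proj_eq_self h]
    exact ⟨⟨h, h, h'⟩, h, h''⟩

theorem pref_par_parFam_subset {ι : Type} [Fintype ι] {E : ι → Finset A} {Ek : Finset A}
    (hkE : Ek ⊆ Finset.univ.sup E) (L : ι → Set (List A)) (M : Set (List A)) :
    pref (par (Finset.univ.sup E) Ek (parFam E L) M) ⊆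
      par (Finset.univ.sup E) Ek (parFam E fun i => pref (L i)) (pref M) := by
  rintro w ⟨u, hu⟩
  simp only [mem_par_parFam hkE, append_mem_star, proj_append] at hu ⊢
  exact ⟨hu.1.1, fun i => ⟨_, hu.2.1 i⟩, _, hu.2.2⟩

/-- Strings of private letters can be interleaved. -/
theorem exists_interleaving_of_private {ι : Type} (S : Finset ι) {E : ι → Finset A}
    {Ek : Finset A} (hs : ∀ i j, i ≠ j → E i ∩ E j ⊆ Ek) {x : ι → List A}
    (hx : ∀ i, x i ∈ star (E i)) (hxk : ∀ i, proj Ek (x i) = []) :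
    ∃ w ∈ star (S.sup E), proj Ek w = [] ∧ ∀ i ∈ S, proj (E i) w = x i := by
  classical
  induction S using Finset.induction_on with
  | empty => exact ⟨[], by simp [star], rfl, by simp⟩
  | insert j S hj ih =>
    obtain ⟨w, hw, hwk, hwp⟩ := ih
    refine ⟨w ++ x j, append_mem_star.2 ⟨star_mono (Finset.sup_mono (Finset.subset_insert j S)) hw,
      star_mono (Finset.le_sup (Finset.mem_insert_self j S)) (hx j)⟩, by simp [hwk, hxk], ?_⟩
    intro i hi
    rw [proj_append]
    rcases Finset.mem_insert.1 hi with rfl | hi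
    · rw [proj_eq_self (hx i), proj_eq_nil.2, List.nil_append]
      intro a ha hai
      obtain ⟨l, hl, hal⟩ := Finset.mem_sup.1 (hw a ha)
      have hil : i ≠ l := fun h => hj (h ▸ hl)
      exact proj_eq_nil.1 hwk a ha (hs i l hil (Finset.mem_inter.2 ⟨hai, hal⟩))
    · rw [hwp i hi, proj_eq_nil.2, List.append_nil]
      intro a ha hai
      have hij : i ≠ j := fun h => hj (h ▸ hi)
      exact proj_eq_nil.1 (hxk j) a ha
        (hs i j hij (Finset.mem_inter.2 ⟨hai, hx j a ha⟩))

/-- Strings with a common projection to the shared alphabet can be synchronized. -/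
theorem exists_synchronization {ι : Type} [Fintype ι] [Nonempty ι] {E : ι → Finset A}
    {Ek : Finset A} (hs : ∀ i j, i ≠ j → E i ∩ E j ⊆ Ek) (t : List A) (x : ι → List A)
    (hx : ∀ i, x i ∈ star (E i)) (hxt : ∀ i, proj Ek (x i) = t) :
    ∃ w ∈ star (Finset.univ.sup E), proj Ek w = t ∧ ∀ i, proj (E i) w = x i := by
  induction t generalizing x with
  | nil => simpa using exists_interleaving_of_private Finset.univ hs hx hxt
  | cons a t ih =>
    have hsplit : ∀ i, ∃ y z, x i = y ++ a :: z ∧ proj Ek y = [] ∧ a ∈ Ek ∧ proj Ek z = t := by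
      intro i
      obtain ⟨y, z, h, hy, ha, hz⟩ := List.filter_eq_cons_iff.1 (hxt i)
      exact ⟨y, z, h, proj_eq_nil.2 (by simpa using hy), by simpa using ha, hz⟩
    choose y z hxyz hy ha hz using hsplit
    have hmem : ∀ i, y i ∈ star (E i) ∧ a ∈ E i ∧ z i ∈ star (E i) := by
      intro i
      have h := hx i
      rw [hxyz i, append_mem_star, ← List.singleton_append, append_mem_star] at h
      exact ⟨h.1, h.2.1 a (by simp), h.2.2⟩
    obtain ⟨v, hv, hvk, hvp⟩ :=
      exists_interleaving_of_private Finset.univ hs (fun i => (hmem i).1) hy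
    obtain ⟨w, hw, hwk, hwp⟩ := ih z (fun i => (hmem i).2.2) hz
    obtain ⟨i₀⟩ := ‹Nonempty ι›
    have hcons : ∀ E₀ : Finset A, a ∈ E₀ → proj E₀ (a :: w) = a :: proj E₀ w :=
      fun E₀ h => List.filter_cons_of_pos (by simpa using h)
    refine ⟨v ++ a :: w, append_mem_star.2 ⟨hv, ?_⟩, ?_, fun i => ?_⟩
    · intro b hb
      rcases List.mem_cons.1 hb with rfl | hb
      · exact Finset.le_sup (f := E) (Finset.mem_univ i₀) (hmem i₀).2.1
      · exact hw b hb
    · rw [proj_append, hcons _ (ha i₀), hvk, hwk, List.nil_append]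
    · rw [proj_append, hcons _ (hmem i).2.1, hvp i (Finset.mem_univ i), hwp, ← hxyz]

/-- Observers allow every string of the composed prefix closures to be completed. -/
theorem par_pref_subset_pref_par {ι : Type} [Fintype ι] [Nonempty ι] {E : ι → Finset A}
    {Ek : Finset A} (hs : ∀ i j, i ≠ j → E i ∩ E j ⊆ Ek) (hkE : Ek ⊆ Finset.univ.sup E)
    {K : ι → Set (List A)} {Kk : Set (List A)} (hKE : ∀ i, K i ⊆ star (E i))
    (hKk : ∀ i, Kk ⊆ proj Ek '' K i) (hobs : ∀ i, observer (E i) (E i ∩ Ek) (K i)) :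
    par (Finset.univ.sup E) Ek (parFam E fun i => pref (K i)) (pref Kk) ⊆
      pref (par (Finset.univ.sup E) Ek (parFam E K) Kk) := by
  intro s hsN
  obtain ⟨hsE, hsK, t, ht⟩ := (mem_par_parFam hkE).1 hsN
  have hcompl : ∀ i, ∃ u ∈ star (E i), proj (E i) s ++ u ∈ K i ∧ proj Ek u = t := by
    intro i
    obtain ⟨k, hk, hkt⟩ := hKk i ht
    have hkt' : proj (E i ∩ Ek) k = proj Ek s ++ t :=
      (proj_inter_of_mem_star (hKE i hk)).trans hkt
    have hsi : proj (E i ∩ Ek) (proj (E i) s) = proj Ek s := by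
      rw [proj_proj, Finset.inter_right_comm, Finset.inter_self, ← proj_proj]
      refine proj_eq_self fun a ha => hKE i hk a ?_
      have hak : a ∈ proj Ek k := hkt ▸ List.mem_append_left t ha
      exact List.mem_of_mem_filter hak
    obtain ⟨u, hu, huK, hut⟩ := hobs i _ ⟨k, hk, hkt'⟩ _ (hsK i)
      (hsi ▸ List.prefix_append _ _)
    rw [proj_append, hsi, List.append_cancel_left_eq, proj_inter_of_mem_star hu] at hut
    exact ⟨u, hu, huK, hut⟩
  choose u hu huK hut using hcompl
  obtain ⟨w, hw, hwk, hwp⟩ := exists_synchronization hs t u hu hut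
  refine ⟨w, (mem_par_parFam hkE).2 ⟨append_mem_star.2 ⟨hsE, hw⟩, fun i => ?_, ?_⟩⟩
  · rw [proj_append, hwp]
    exact huK i
  · rwa [proj_append, hwk]

/-- Corollary 3: with nonblocking generators,
`K_k = ∩ᵢ P_k(Kᵢ)`, `N_k = ∩ᵢ P_k(Nᵢ)`, and the projections from `Eᵢ*` onto
`(Eᵢ ∩ E_k)*` being `Kᵢ`-observers, the coordinated system is nonblocking iff
the coordinator is nonblocking, i.e., `overline(K_k) = N_k`. -/
theorem stmt16 {A : Type} [DecidableEq A] {n : ℕ} (hn : 2 ≤ n)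
    (E : Fin n → Finset A) (Ek : Finset A)
    (hs : ∀ i j, i ≠ j → E i ∩ E j ⊆ Ek)
    (hkE : Ek ⊆ Finset.univ.sup E)
    (K N : Fin n → Set (List A)) (Kk Nk : Set (List A))
    (hKE : ∀ i, K i ⊆ star (E i)) (hKkE : Kk ⊆ star Ek)
    (hNB : ∀ i, N i = pref (K i)) (hNBk : Nk = pref Kk)
    (hKk : Kk = ⋂ i, proj Ek '' K i) (hNk : Nk = ⋂ i, proj Ek '' N i)
    (hobs : ∀ i, observer (E i) (E i ∩ Ek) (K i)) :
    pref (par (Finset.univ.sup E) Ek (parFam E K) Kk) =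
        par (Finset.univ.sup E) Ek (parFam E N) Nk ↔
      pref Kk = Nk := by
  have : Nonempty (Fin n) := ⟨⟨0, by omega⟩⟩
  refine iff_of_true ?_ hNBk.symm
  obtain rfl : N = fun i => pref (K i) := funext hNB
  subst hNBk
  exact (pref_par_parFam_subset hkE K Kk).antisymm
    (par_pref_subset_pref_par hs hkE hKE (fun i => hKk ▸ Set.iInter_subset _ i) hobs)

end DES
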